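/- For each i ∈ ℤ/3ℤ, the Bäcklund transformation s_i commutes with the time evolution t of the q-Painlevé IV symmetric form: for all a = (a₀,a₁,a₂) ∈ (ℂ∖{0})³ and f = (f₀,f₁,f₂) ∈ ℂ³ such that all denominators appearing in the four compositions are nonzero, t(s_i(a,f)) = s_i(t(a,f)). -/

import Mathlib

noncomputable section

/-- The type `A₂⁽¹⁾` generalized Cartan matrix. -/
def cartanA2 (i j : ZMod 3) : ℤ := if i = j then 2 else -1

/-- An orientation matrix of the `A₂⁽¹⁾` Dynkin diagram. -/
def orientA2 (i j : ZMod 3) : ℤ := if i = j then 0 else if j = i + 1 then 1 else -1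

/-- The Bäcklund transformation `sᵢ` of the symmetric form of q-Painlevé IV. -/
def sBT (i : ZMod 3) (p : (ZMod 3 → ℂ) × (ZMod 3 → ℂ)) : (ZMod 3 → ℂ) × (ZMod 3 → ℂ) :=
  (fun j => p.1 j * p.1 i ^ (-(cartanA2 i j)),
   fun j => p.2 j * ((p.1 i + p.2 i) / (1 + p.1 i * p.2 i)) ^ (orientA2 i j))

/-- The denominators (and the factor raised to a negative power) arising when applying `sᵢ`
are nonzero. -/
def okBT (i : ZMod 3) (p : (ZMod 3 → ℂ) × (ZMod 3 → ℂ)) : Prop :=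
  1 + p.1 i * p.2 i ≠ 0 ∧ p.1 i + p.2 i ≠ 0

/-- The `j`-th denominator arising in the time evolution of q-Painlevé IV. -/
def tDen (p : (ZMod 3 → ℂ) × (ZMod 3 → ℂ)) (j : ZMod 3) : ℂ :=
  1 + p.1 j * p.2 j + p.1 j * p.1 (j + 1) * p.2 j * p.2 (j + 1)

/-- The discrete time evolution `t` of the symmetric form of q-Painlevé IV. -/
def tEv (p : (ZMod 3 → ℂ) × (ZMod 3 → ℂ)) : (ZMod 3 → ℂ) × (ZMod 3 → ℂ) :=
  (p.1, fun j => p.1 j * p.1 (j + 1) * p.2 (j + 1) *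
    (1 + p.1 (j + 2) * p.2 (j + 2) + p.1 (j + 2) * p.1 j * p.2 (j + 2) * p.2 j) /
    tDen p j)

lemma ZMod.three_eq_or (i j : ZMod 3) : j = i ∨ j = i + 1 ∨ j = i + 2 := by
  decide +revert

section BacklundTransformation

variable (i : ZMod 3) (p : (ZMod 3 → ℂ) × (ZMod 3 → ℂ))

lemma ZMod.three_add_one_add_one : i + 1 + 1 = i + 2 := by decide +revert

lemma ZMod.three_add_one_add_two : i + 1 + 2 = i := by decide +revert

lemma ZMod.three_add_two_add_one : i + 2 + 1 = i := by decide +revert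

lemma ZMod.three_add_two_add_two : i + 2 + 2 = i + 1 := by decide +revert

lemma cartanA2_self : cartanA2 i i = 2 := by decide +revert

lemma cartanA2_add_one : cartanA2 i (i + 1) = -1 := by decide +revert

lemma cartanA2_add_two : cartanA2 i (i + 2) = -1 := by decide +revert

lemma orientA2_self : orientA2 i i = 0 := by decide +revert

lemma orientA2_add_one : orientA2 i (i + 1) = 1 := by decide +revert

lemma orientA2_add_two : orientA2 i (i + 2) = -1 := by decide +revert

lemma sBT_fst_self (h : p.1 i ≠ 0) : (sBT i p).1 i = (p.1 i)⁻¹ := by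
  simp only [sBT, cartanA2_self, zpow_neg]
  norm_cast
  field_simp

lemma sBT_fst_add_one : (sBT i p).1 (i + 1) = p.1 (i + 1) * p.1 i := by
  simp [sBT, cartanA2_add_one]

lemma sBT_fst_add_two : (sBT i p).1 (i + 2) = p.1 (i + 2) * p.1 i := by
  simp [sBT, cartanA2_add_two]

lemma sBT_snd_self : (sBT i p).2 i = p.2 i := by
  simp [sBT, orientA2_self]

lemma sBT_snd_add_one :
    (sBT i p).2 (i + 1) = p.2 (i + 1) * ((p.1 i + p.2 i) / (1 + p.1 i * p.2 i)) := by
  simp [sBT, orientA2_add_one]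

lemma sBT_snd_add_two :
    (sBT i p).2 (i + 2) = p.2 (i + 2) * ((1 + p.1 i * p.2 i) / (p.1 i + p.2 i)) := by
  simp [sBT, orientA2_add_two]

/-- The numerators of the time evolution are again the denominators `tDen`. -/
lemma tEv_snd (j : ZMod 3) :
    (tEv p).2 j = p.1 j * p.1 (j + 1) * p.2 (j + 1) * tDen p (j + 2) / tDen p j := by
  simp only [tEv, tDen, ZMod.three_add_two_add_one]

lemma tDen_sBT_self (h : p.1 i ≠ 0) (hi : okBT i p) :
    tDen (sBT i p) i = (p.1 i + p.2 i) * tDen p i / (p.1 i * (1 + p.1 i * p.2 i)) := by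
  have h₁ := hi.1
  simp only [tDen, sBT_fst_self i p h, sBT_fst_add_one, sBT_snd_self, sBT_snd_add_one]
  field_simp

lemma tDen_sBT_add_two (h : p.1 i ≠ 0) (hi : okBT i p) :
    tDen (sBT i p) (i + 2) = tDen p (i + 2) := by
  have h₂ := hi.2
  simp only [tDen, ZMod.three_add_two_add_one, sBT_fst_self i p h, sBT_fst_add_two,
    sBT_snd_self, sBT_snd_add_two]
  field_simp
  ring

lemma tDen_sBT_add_one (hi : okBT i p) (hD : tDen p i ≠ 0) :
    tDen (sBT i p) (i + 1) =
      (1 + p.1 i * (tEv p).2 i) * tDen p i / (1 + p.1 i * p.2 i) := by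
  obtain ⟨h₁, h₂⟩ := hi
  rw [tEv_snd, eq_div_iff h₁, add_mul, ← mul_div_assoc, div_mul_cancel₀ _ hD]
  simp only [tDen, ZMod.three_add_one_add_one, ZMod.three_add_two_add_one, sBT_fst_add_one,
    sBT_fst_add_two, sBT_snd_add_one, sBT_snd_add_two]
  field_simp
  ring

lemma add_tEv_snd (hD : tDen p i ≠ 0) :
    p.1 i + (tEv p).2 i =
      p.1 i * (1 + p.1 i * p.2 i) * tDen p (i + 1) / tDen p i := by
  rw [tEv_snd, eq_div_iff hD, add_mul, div_mul_cancel₀ _ hD]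
  simp only [tDen, ZMod.three_add_one_add_one, ZMod.three_add_two_add_one]
  ring

end BacklundTransformation

theorem tEv_comm_sBT (i : ZMod 3) (a f : ZMod 3 → ℂ)
    (ha : ∀ j, a j ≠ 0)
    (h1 : okBT i (a, f))
    (h2 : ∀ j, tDen (sBT i (a, f)) j ≠ 0)
    (h3 : ∀ j, tDen (a, f) j ≠ 0)
    (h4 : okBT i (tEv (a, f))) :
    tEv (sBT i (a, f)) = sBT i (tEv (a, f)) := by
  have hai := ha i
  have hD₀ := h3 i
  have hD₁ := h3 (i + 1)
  have hD₂ := h3 (i + 2)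
  have e₀ := tDen_sBT_self i (a, f) hai h1
  have e₁ := tDen_sBT_add_one i (a, f) h1 hD₀
  have e₂ := tDen_sBT_add_two i (a, f) hai h1
  obtain ⟨h₁, h₂⟩ := h1
  obtain ⟨h₃, -⟩ := h4
  have hadd := add_tEv_snd i (a, f) hD₀
  refine Prod.ext rfl (funext fun j => ?_)
  rcases ZMod.three_eq_or i j with rfl | rfl | rfl
  · rw [sBT_snd_self, tEv_snd, tEv_snd, e₀, e₂, sBT_fst_self _ _ hai, sBT_fst_add_one,
      sBT_snd_add_one]
    dsimp only at *
    field_simp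
  · rw [sBT_snd_add_one, tEv_snd, tEv_snd _ (i + 1)]
    rw [ZMod.three_add_one_add_one, ZMod.three_add_one_add_two, e₀, e₁, sBT_fst_add_one,
      sBT_fst_add_two, sBT_snd_add_two]
    change _ = _ * (((a, f).1 i + _) / (1 + (a, f).1 i * _))
    rw [hadd]
    dsimp only [tEv] at h₁ h₂ h₃ ⊢
    field_simp
  · rw [sBT_snd_add_two, tEv_snd, tEv_snd _ (i + 2)]
    rw [ZMod.three_add_two_add_one, ZMod.three_add_two_add_two, e₁, e₂, sBT_fst_self _ _ hai,
      sBT_fst_add_two, sBT_snd_self]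
    change _ = _ * ((1 + (a, f).1 i * _) / ((a, f).1 i + _))
    rw [hadd]
    dsimp only [tEv] at h₁ h₂ h₃ ⊢
    field_simp

end
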